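/- arXiv:2305.06926 — 8 statements merged into one kernel-verified Lean document; each statement's English description precedes it below -/
import Mathlib

section
/- Let X and Y be locally compact Hausdorff topological spaces and let π : X → Y be a surjective local homeomorphism. Then for every continuous compactly supported function f : X → ℂ and every y ∈ Y, the set {x ∈ π⁻¹(y) : f(x) ≠ 0} is finite, and the function μ(f) : Y → ℂ defined by μ(f)(y) = ∑_{x ∈ π⁻¹(y)} f(x) is continuous and has compact support. (Thus the family of counting measures on the fibres of π is a continuous family of measures along π.) -/
open scoped BigOperators

/-- A compact set meets each fibre of a local homeomorphism in finitely many points. -/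
theorem IsLocalHomeomorph.finite_fiber_inter {X Y : Type*} [TopologicalSpace X]
    [TopologicalSpace Y] [T1Space Y] {π : X → Y} (hπ : IsLocalHomeomorph π)
    {K : Set X} (hK : IsCompact K) (y : Y) : (K ∩ π ⁻¹' {y}).Finite := by
  choose e hxe he using hπ
  have hc : IsCompact (K ∩ π ⁻¹' {y}) :=
    hK.inter_right (isClosed_singleton.preimage (IsLocalHomeomorph.continuous
      fun x => ⟨e x, hxe x, he x⟩))
  obtain ⟨t, ht, hcov⟩ := hc.elim_nhds_subcover (fun x => (e x).source)
    (fun x _ => (e x).open_source.mem_nhds (hxe x))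
  refine t.finite_toSet.subset fun x hx => ?_
  obtain ⟨z, hz, hxz⟩ := Set.mem_iUnion₂.1 (hcov hx)
  have hxy : π x = y := hx.2
  have hzy : π z = y := (ht z hz).2
  have : x = z := (e z).injOn hxz (hxe z) (by rw [← he z, hxy, hzy])
  exact this ▸ hz

open Topology in
/-- The fibrewise sum of a continuous compactly supported function along a local homeomorphism
is continuous. -/
theorem IsLocalHomeomorph.continuous_finsum_fiber {X Y M : Type*} [TopologicalSpace X]
    [TopologicalSpace Y] [T2Space X] [T2Space Y] [AddCommMonoid M] [TopologicalSpace M]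
    [ContinuousAdd M] {π : X → Y} (hπ : IsLocalHomeomorph π) {f : X → M} (hf : Continuous f)
    (hfc : HasCompactSupport f) : Continuous fun y => ∑ᶠ x ∈ π ⁻¹' {y}, f x := by
  classical
  refine continuous_iff_continuousAt.2 fun y => ?_
  have hfin := hπ.finite_fiber_inter hfc y
  obtain ⟨U, hU, hdisj⟩ := hfin.t2_separation
  have hcont := hπ.continuous
  choose e hxe he using hπ
  set F := hfin.toFinset
  have hFy : ∀ x ∈ F, π x = y := fun x hx => (hfin.mem_toFinset.1 hx).2
  have htarget : ∀ x ∈ F, y ∈ (e x).target := fun x hx => by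
    rw [← hFy x hx, congrFun (he x) x]
    exact (e x).map_source (hxe x)
  have hsymm : ∀ x ∈ F, (e x).symm y = x := fun x hx => by
    rw [← hFy x hx, congrFun (he x) x]
    exact (e x).left_inv (hxe x)
  have hsc : ∀ x ∈ F, ContinuousAt (e x).symm y := fun x hx =>
    (e x).symm.continuousAt (htarget x hx)
  have hlim : ContinuousAt (fun y' => ∑ x ∈ F, f ((e x).symm y')) y :=
    tendsto_finsetSum _ fun x hx => hf.continuousAt.comp (hsc x hx)
  refine hlim.congr ?_
  have hWopen : IsOpen (⋃ x ∈ F, U x ∩ (e x).source) :=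
    isOpen_biUnion fun x _ => (hU x).2.inter (e x).open_source
  have hclosed : IsClosed (π '' (tsupport f \ ⋃ x ∈ F, U x ∩ (e x).source)) :=
    ((IsCompact.diff hfc hWopen).image hcont).isClosed
  have hy : y ∉ π '' (tsupport f \ ⋃ x ∈ F, U x ∩ (e x).source) := by
    rintro ⟨x, ⟨hx, hxn⟩, hxy⟩
    exact hxn (Set.mem_biUnion (hfin.mem_toFinset.2 ⟨hx, hxy⟩) ⟨(hU x).1, hxe x⟩)
  have hmem : ∀ᶠ y' in 𝓝 y, ∀ x ∈ F, y' ∈ (e x).target ∧ (e x).symm y' ∈ U x :=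
    (Filter.eventually_all_finset F).2 fun x hx =>
      ((e x).open_target.eventually_mem (htarget x hx)).and
        ((hsc x hx).eventually_mem ((hU x).2.mem_nhds (by rw [hsymm x hx]; exact (hU x).1)))
  filter_upwards [hclosed.isOpen_compl.mem_nhds hy, hmem] with y' hy' hm
  have hinj : Set.InjOn (fun x => (e x).symm y') F := fun a ha b hb hab => by
    by_contra hne
    refine Set.disjoint_left.1 (hdisj (hfin.mem_toFinset.1 ha) (hfin.mem_toFinset.1 hb) hne)
      (hm a ha).2 ?_
    rw [show (e a).symm y' = (e b).symm y' from hab]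
    exact (hm b hb).2
  rw [← Finset.sum_image (f := f) hinj]
  symm
  apply finsum_mem_eq_sum_of_inter_support_eq
  ext x
  refine and_congr_left fun hx => ?_
  simp only [Set.mem_preimage, Set.mem_singleton_iff, Finset.coe_image, Set.mem_image,
    Finset.mem_coe]
  constructor
  · intro hxy
    have hxW : x ∈ ⋃ z ∈ F, U z ∩ (e z).source := by
      by_contra hxn
      exact hy' ⟨x, ⟨subset_tsupport f hx, hxn⟩, hxy⟩
    obtain ⟨z, hz, hxz⟩ := Set.mem_iUnion₂.1 hxW
    refine ⟨z, hz, ?_⟩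
    rw [← hxy, congrFun (he z) x]
    exact (e z).left_inv hxz.2
  · rintro ⟨z, hz, rfl⟩
    rw [congrFun (he z)]
    exact (e z).right_inv (hm z hz).1

/-- The fibrewise sum of a compactly supported function along a continuous map is compactly
supported. -/
theorem HasCompactSupport.finsum_fiber {X Y M : Type*} [TopologicalSpace X]
    [TopologicalSpace Y] [T2Space Y] [AddCommMonoid M] {π : X → Y} (hπ : Continuous π)
    {f : X → M} (hfc : HasCompactSupport f) :
    HasCompactSupport fun y => ∑ᶠ x ∈ π ⁻¹' {y}, f x := by
  refine HasCompactSupport.intro (IsCompact.image hfc hπ) fun y hy => ?_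
  refine finsum_mem_eq_zero_of_forall_eq_zero fun x hx => ?_
  by_contra hne
  exact hy ⟨x, subset_tsupport f hne, hx⟩

/-- For a surjective local homeomorphism `π : X → Y` between locally compact
Hausdorff spaces and any continuous compactly supported `f : X → ℂ`, each fibre carries only
finitely many points where `f` is nonzero, and the fibrewise sum `y ↦ ∑_{x ∈ π⁻¹(y)} f x` is
continuous with compact support. -/
theorem counting_family_is_continuous_family
    {X Y : Type*} [TopologicalSpace X] [TopologicalSpace Y]
    [LocallyCompactSpace X] [T2Space X] [LocallyCompactSpace Y] [T2Space Y]
    {π : X → Y} (hπ : IsLocalHomeomorph π) (hπsurj : Function.Surjective π)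
    (f : X → ℂ) (hf : Continuous f) (hfc : HasCompactSupport f) :
    (∀ y : Y, {x ∈ π ⁻¹' {y} | f x ≠ 0}.Finite) ∧
    Continuous (fun y : Y => ∑ᶠ x ∈ π ⁻¹' {y}, f x) ∧
    HasCompactSupport (fun y : Y => ∑ᶠ x ∈ π ⁻¹' {y}, f x) := by
  refine ⟨fun y => (hπ.finite_fiber_inter hfc y).subset ?_, hπ.continuous_finsum_fiber hf hfc,
    hfc.finsum_fiber hπ.continuous⟩
  exact fun x hx => ⟨subset_tsupport f hx.2, hx.1⟩
end

section
/- Let X and Y be locally compact Hausdorff topological spaces and let π : X → Y be a surjective local homeomorphism. Then the linear map μ : C_c(X) → C_c(Y) defined by μ(f)(y) = ∑_{x ∈ π⁻¹(y)} f(x) is surjective: for every continuous compactly supported g : Y → ℂ there exists a continuous compactly supported f : X → ℂ with ∑_{x ∈ π⁻¹(y)} f(x) = g(y) for all y ∈ Y. -/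
open scoped BigOperators

open Function Set

/-- `IsFiberSum π h` says that `h` is the fibrewise sum along `π` of a continuous compactly
supported function having finite support on each fibre. -/
def IsFiberSum {X Y : Type*} [TopologicalSpace X] (π : X → Y) (h : Y → ℂ) : Prop :=
  ∃ f : X → ℂ, Continuous f ∧ HasCompactSupport f ∧
    ∀ y : Y, (π ⁻¹' {y} ∩ support f).Finite ∧ (∑ᶠ x ∈ π ⁻¹' {y}, f x) = h y

theorem IsFiberSum.zero {X Y : Type*} [TopologicalSpace X] (π : X → Y) :
    IsFiberSum π (0 : Y → ℂ) :=
  ⟨0, continuous_zero, HasCompactSupport.zero, fun y => by simp⟩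

theorem IsFiberSum.add {X Y : Type*} [TopologicalSpace X] {π : X → Y} {h₁ h₂ : Y → ℂ}
    (H₁ : IsFiberSum π h₁) (H₂ : IsFiberSum π h₂) : IsFiberSum π (h₁ + h₂) := by
  obtain ⟨f₁, c₁, s₁, F₁⟩ := H₁
  obtain ⟨f₂, c₂, s₂, F₂⟩ := H₂
  refine ⟨f₁ + f₂, c₁.add c₂, s₁.add s₂, fun y => ⟨?_, ?_⟩⟩
  · refine ((F₁ y).1.union (F₂ y).1).subset ?_
    rw [← inter_union_distrib_left]
    exact inter_subset_inter_right _ (support_add f₁ f₂)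
  · simp only [Pi.add_apply]
    rw [finsum_mem_add_distrib' (F₁ y).1 (F₂ y).1, (F₁ y).2, (F₂ y).2]

/-- A function compactly supported in the target of a local inverse of `π` is a fibrewise sum. -/
theorem OpenPartialHomeomorph.isFiberSum {X Y : Type*} [TopologicalSpace X] [TopologicalSpace Y]
    [T2Space X] (e : OpenPartialHomeomorph X Y) {h : Y → ℂ} (hc : Continuous h)
    (hs : HasCompactSupport h) (ht : tsupport h ⊆ e.target) : IsFiberSum e h := by
  classical
  have hK : IsCompact (e.symm '' tsupport h) :=
    hs.isCompact.image_of_continuousOn (e.continuousOn_symm.mono ht)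
  have hsupp : support (e.source.indicator (h ∘ e)) ⊆ e.symm '' tsupport h := by
    intro x hx
    obtain ⟨hxs, hx⟩ := by simpa using hx
    exact ⟨e x, subset_tsupport h hx, e.left_inv hxs⟩
  have hfib (y : Y) : e ⁻¹' {y} ∩ support (e.source.indicator (h ∘ e)) ⊆ {e.symm y} := by
    rintro x ⟨rfl, hx⟩
    exact (e.left_inv (support_indicator_subset hx)).symm
  refine ⟨e.source.indicator (h ∘ e), ?_, HasCompactSupport.of_support_subset_isCompact hK hsupp,
    fun y => ⟨(finite_singleton _).subset (hfib y), ?_⟩⟩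
  · rw [continuous_iff_continuousAt]
    intro x
    by_cases hx : x ∈ e.source
    · refine (hc.continuousAt.comp (e.continuousAt hx)).congr ?_
      filter_upwards [e.open_source.mem_nhds hx] with z hz
      rw [indicator_of_mem hz]
    · have hx' : x ∉ e.symm '' tsupport h := by
        rintro ⟨y, hy, rfl⟩
        exact hx (e.map_target (ht hy))
      refine (continuousAt_const (y := (0 : ℂ))).congr ?_
      filter_upwards [hK.isClosed.isOpen_compl.mem_nhds hx'] with z hz
      exact (notMem_support.1 fun hz' => hz (hsupp hz')).symm
  · by_cases hy : y ∈ e.target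
    · have hval : e.source.indicator (h ∘ e) (e.symm y) = h y := by
        rw [indicator_of_mem (e.map_target hy), comp_apply, e.right_inv hy]
      rw [← finsum_mem_inter_support, ← hval, ← finsum_mem_singleton (a := e.symm y)
        (f := e.source.indicator (h ∘ e)), ← finsum_mem_inter_support _ {e.symm y}]
      refine finsum_mem_congr (Subset.antisymm (fun x hx => ⟨hfib y hx, hx.2⟩) ?_) fun _ _ => rfl
      rintro x ⟨rfl, hx⟩
      exact ⟨e.right_inv hy, hx⟩
    · rw [notMem_support.1 fun h' => hy (ht (subset_tsupport h h'))]
      refine finsum_mem_eq_zero_of_forall_eq_zero ?_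
      rintro x rfl
      exact indicator_of_notMem (fun hx => hy (e.map_source hx)) _

/-- For a surjective local homeomorphism `π : X → Y` between locally compact
Hausdorff spaces, the map `μ : C_c(X) → C_c(Y)`, `μ(f)(y) = ∑_{x ∈ π⁻¹(y)} f x`, is surjective:
every continuous compactly supported `g : Y → ℂ` arises from some continuous compactly
supported `f : X → ℂ`. -/
theorem counting_family_surjective_on_Cc
    {X Y : Type*} [TopologicalSpace X] [TopologicalSpace Y]
    [LocallyCompactSpace X] [T2Space X] [LocallyCompactSpace Y] [T2Space Y]
    {π : X → Y} (hπ : IsLocalHomeomorph π) (hπsurj : Function.Surjective π)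
    (g : Y → ℂ) (hg : Continuous g) (hgc : HasCompactSupport g) :
    ∃ f : X → ℂ, Continuous f ∧ HasCompactSupport f ∧
      ∀ y : Y, (∑ᶠ x ∈ π ⁻¹' {y}, f x) = g y := by
  choose σ hσ using hπsurj
  choose e hxe he using hπ
  obtain ⟨t, ht⟩ := hgc.isCompact.elim_finite_subcover (fun y => (e (σ y)).target)
    (fun y => (e (σ y)).open_target) fun y _ => mem_iUnion.2 ⟨y, by
      have := (e (σ y)).map_source (hxe (σ y))
      rwa [← he, hσ] at this⟩
  have hcover : tsupport g ⊆ ⋃ i, (e (σ (t.equivFin.symm i))).target := by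
    intro y hy
    obtain ⟨z, hz, hyz⟩ := mem_iUnion₂.1 (ht hy)
    exact mem_iUnion.2 ⟨t.equivFin ⟨z, hz⟩, by simpa using hyz⟩
  obtain ⟨p, hpt, hp1, -, -⟩ := exists_continuous_sum_one_of_isOpen_isCompact
    (fun i => (e (σ (t.equivFin.symm i))).open_target) hgc.isCompact hcover
  have hsum : g = ∑ i, fun y => (p i y : ℂ) * g y := by
    ext y
    rw [Finset.sum_apply, ← Finset.sum_mul]
    by_cases hy : y ∈ tsupport g
    · have := hp1 hy
      simp only [Finset.sum_apply, Pi.one_apply] at this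
      rw [← Complex.ofReal_sum, this, Complex.ofReal_one, one_mul]
    · rw [image_eq_zero_of_notMem_tsupport hy, mul_zero]
  have hfiber : IsFiberSum π g := by
    rw [hsum]
    refine Finset.sum_induction _ (IsFiberSum π) (fun _ _ => IsFiberSum.add)
      (IsFiberSum.zero π) fun i _ => ?_
    rw [he (σ (t.equivFin.symm i))]
    refine OpenPartialHomeomorph.isFiberSum _ (by fun_prop) hgc.mul_left
      ((closure_mono ?_).trans (hpt i))
    intro y hy hpy
    exact hy (by simp [hpy])
  obtain ⟨f, hf, hfc, hfs⟩ := hfiber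
  exact ⟨f, hf, hfc, fun y => (hfs y).2⟩
end

section
/- Let X be a locally compact Hausdorff space and let R be an equivalence relation on X whose quotient map q : X → X/R is an open map, and suppose the quotient space X/R is Hausdorff and paracompact. Then there exists a continuous function e : X → ℝ with e ≥ 0 such that: (1) e is not identically zero on any equivalence class of R; and (2) for every compact subset K of X/R, the intersection q⁻¹(K) ∩ supp(e) is compact, where supp(e) denotes the closure of {x : e(x) ≠ 0}. -/
open Function Set Topology in
/-- A continuous open surjection from a locally compact Hausdorff space onto a paracompact
Hausdorff space admits a cutoff function. -/
theorem IsOpenMap.exists_cutoff {X Y : Type*} [TopologicalSpace X] [TopologicalSpace Y]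
    [LocallyCompactSpace X] [T2Space X] [T2Space Y] [ParacompactSpace Y] {q : X → Y}
    (hopen : IsOpenMap q) (hcont : Continuous q) (hsurj : Surjective q) :
    ∃ e : X → ℝ, Continuous e ∧ (∀ x, 0 ≤ e x) ∧ (∀ x, ∃ x', q x' = q x ∧ e x' ≠ 0) ∧
      ∀ K : Set Y, IsCompact K → IsCompact (q ⁻¹' K ∩ tsupport e) := by
  choose f hfc hf0 hfx using fun x : X ↦ exists_continuous_nonneg_pos x
  obtain ⟨ρ, hρ⟩ := PartitionOfUnity.exists_isSubordinate (isClosed_univ (X := Y))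
    (fun x ↦ q '' support (f x)) (fun x ↦ hopen _ (f x).continuous.isOpen_support) (by
      intro y _
      obtain ⟨x, rfl⟩ := hsurj y
      exact mem_iUnion.2 ⟨x, mem_image_of_mem q (hfx x)⟩)
  set g : X → X → ℝ := fun i x ↦ ρ i (q x) * f i x
  have hg0 : ∀ i x, 0 ≤ g i x := fun i x ↦ mul_nonneg (ρ.nonneg i _) (hf0 i x)
  have hgρ : ∀ i, support (g i) ⊆ q ⁻¹' support (ρ i) := fun i x hx ↦ left_ne_zero_of_mul hx
  have hgf : ∀ i, support (g i) ⊆ support (f i) := fun i x hx ↦ right_ne_zero_of_mul hx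
  have hlf : LocallyFinite fun i ↦ support (g i) :=
    (ρ.locallyFinite.preimage_continuous hcont).subset hgρ
  refine ⟨fun x ↦ ∑ᶠ i, g i x, continuous_finsum (fun i ↦ by fun_prop) hlf,
    fun x ↦ finsum_nonneg fun i ↦ hg0 i x, fun x ↦ ?_, fun K hK ↦ ?_⟩
  · obtain ⟨i, hi⟩ := ρ.exists_pos (mem_univ (q x))
    obtain ⟨x', hx', hq⟩ := hρ i (subset_tsupport _ hi.ne')
    refine ⟨x', hq, ne_of_gt ?_⟩
    have hpos : 0 < g i x' := mul_pos (hq ▸ hi) ((hf0 i x').lt_of_ne' hx')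
    exact hpos.trans_le <| single_le_finsum i (hlf.point_finite x') fun j ↦ hg0 j x'
  · have hfin := ρ.locallyFinite_tsupport.finite_nonempty_inter_compact hK
    refine (hfin.isCompact_biUnion fun i _ ↦ (hfc i : IsCompact (tsupport (f i)))).of_isClosed_subset
      ((hK.isClosed.preimage hcont).inter (isClosed_tsupport _)) ?_
    rintro x ⟨hxK, hx⟩
    have hsupp : support (fun x ↦ ∑ᶠ i, g i x) ⊆ ⋃ i, support (g i) := fun y hy ↦ by
      contrapose! hy
      simp_all
    have hx' := closure_mono hsupp hx
    rw [hlf.closure_iUnion, mem_iUnion] at hx'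
    obtain ⟨i, hi⟩ := hx'
    exact mem_biUnion
      (show i ∈ {i | (tsupport (ρ i) ∩ K).Nonempty} from
        ⟨q x, hcont.closure_preimage_subset _ (closure_mono (hgρ i) hi), hxK⟩)
      (closure_mono (hgf i) hi)

/-- Bourbaki cutoff lemma: Let `X` be locally compact Hausdorff, `R` an
equivalence relation on `X` with open quotient map `q : X → X/R`, and suppose `X/R` is
Hausdorff and paracompact. Then there is a continuous `e : X → ℝ`, `e ≥ 0`, which is not
identically zero on any equivalence class, and such that `q⁻¹(K) ∩ supp e` is compact for
every compact `K ⊆ X/R`. -/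
theorem exists_cutoff_function
    {X : Type*} [TopologicalSpace X] [LocallyCompactSpace X] [T2Space X]
    (R : Setoid X)
    (hopen : IsOpenMap (Quotient.mk R))
    (hT2 : T2Space (Quotient R)) (hpara : ParacompactSpace (Quotient R)) :
    ∃ e : X → ℝ, Continuous e ∧ (∀ x, 0 ≤ e x) ∧
      (∀ x : X, ∃ x' : X, R.r x x' ∧ e x' ≠ 0) ∧
      (∀ K : Set (Quotient R), IsCompact K →
        IsCompact (Quotient.mk R ⁻¹' K ∩ closure {x : X | e x ≠ 0})) := by
  obtain ⟨e, hcont, hnonneg, hne, hcpt⟩ :=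
    hopen.exists_cutoff continuous_quotient_mk' Quotient.mk_surjective
  refine ⟨e, hcont, hnonneg, fun x ↦ ?_, hcpt⟩
  obtain ⟨x', hq, hx'⟩ := hne x
  exact ⟨x', Quotient.exact hq.symm, hx'⟩
end

section
/- Let p : E → X be a covering map, where E is locally compact Hausdorff and X is locally compact, Hausdorff and paracompact. Then there exists a continuous function h : E → ℝ with 0 ≤ h ≤ 1 such that: (1) for every x ∈ X, the set {e ∈ p⁻¹(x) : h(e) ≠ 0} is finite and ∑_{e ∈ p⁻¹(x)} h(e) = 1; and (2) for every compact subset K of X, the intersection p⁻¹(K) ∩ supp(h) is compact, where supp(h) denotes the closure of {e : h(e) ≠ 0}. -/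
open scoped BigOperators

section SheetLift

variable {E X : Type*} [TopologicalSpace E] [TopologicalSpace X]

open scoped Classical in
/-- The function on `E` that equals `f ∘ φ` on the source of `φ` and vanishes elsewhere. -/
noncomputable def sheetLift (φ : OpenPartialHomeomorph E X) (f : X → ℝ) (e : E) : ℝ :=
  if e ∈ φ.source then f (φ e) else 0

variable {φ : OpenPartialHomeomorph E X} {f : X → ℝ}

theorem mem_source_of_sheetLift_ne_zero {e : E} (h : sheetLift φ f e ≠ 0) : e ∈ φ.source := by
  by_contra he
  exact h (if_neg he)

theorem sheetLift_of_mem_source {e : E} (he : e ∈ φ.source) : sheetLift φ f e = f (φ e) :=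
  if_pos he

variable (φ f)

theorem sheetLift_symm_apply {x : X} (hx : x ∈ φ.target) : sheetLift φ f (φ.symm x) = f x := by
  rw [sheetLift_of_mem_source (φ.map_target hx), φ.right_inv hx]

theorem support_sheetLift_subset :
    Function.support (sheetLift φ f) ⊆ φ.symm '' tsupport f := by
  intro e he
  have hs := mem_source_of_sheetLift_ne_zero he
  rw [Function.mem_support, sheetLift_of_mem_source hs] at he
  exact ⟨φ e, subset_tsupport f he, φ.left_inv hs⟩

variable {f}

theorem sheetLift_nonneg (hf : ∀ x, 0 ≤ f x) (e : E) : 0 ≤ sheetLift φ f e := by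
  unfold sheetLift
  split_ifs
  exacts [hf _, le_rfl]

theorem sheetLift_le (hf : ∀ x, 0 ≤ f x) (e : E) : sheetLift φ f e ≤ f (φ e) := by
  unfold sheetLift
  split_ifs
  exacts [le_rfl, hf _]

theorem isCompact_symm_image {s : Set X} (hs : IsCompact s) (hst : s ⊆ φ.target) :
    IsCompact (φ.symm '' s) :=
  hs.image_of_continuousOn (φ.continuousOn_symm.mono hst)

theorem continuous_sheetLift [T2Space E] (hf : Continuous f) (hc : IsCompact (tsupport f))
    (ht : tsupport f ⊆ φ.target) : Continuous (sheetLift φ f) := by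
  refine continuous_iff_continuousAt.2 fun e ↦ ?_
  by_cases he : e ∈ φ.source
  · refine (hf.continuousAt.comp (φ.continuousAt he)).congr ?_
    filter_upwards [φ.open_source.mem_nhds he] with y hy
    exact (sheetLift_of_mem_source hy).symm
  · have hmem : e ∉ φ.symm '' tsupport f := by
      rintro ⟨x, hx, rfl⟩
      exact he (φ.map_target (ht hx))
    refine (continuousAt_const (y := (0 : ℝ))).congr ?_
    filter_upwards [(isCompact_symm_image φ hc ht).isClosed.isOpen_compl.mem_nhds hmem] with y hy
    by_contra h
    exact hy (support_sheetLift_subset φ f (Ne.symm h))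

end SheetLift

/-- For a covering map `p : E → X` with `E` locally compact Hausdorff and `X`
locally compact Hausdorff paracompact, there is a continuous cutoff `h : E → ℝ`, `0 ≤ h ≤ 1`,
which is nonzero at only finitely many points of each fibre, sums to `1` on each fibre, and
such that `p⁻¹(K) ∩ supp h` is compact for every compact `K ⊆ X`. -/
theorem exists_normalized_cutoff_for_covering
    {E X : Type*} [TopologicalSpace E] [LocallyCompactSpace E] [T2Space E]
    [TopologicalSpace X] [LocallyCompactSpace X] [T2Space X] [ParacompactSpace X]
    {p : E → X} (hp : IsCoveringMap p) (hpsurj : Function.Surjective p) :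
    ∃ h : E → ℝ, Continuous h ∧ (∀ e : E, 0 ≤ h e ∧ h e ≤ 1) ∧
      (∀ x : X, {e ∈ p ⁻¹' {x} | h e ≠ 0}.Finite ∧ (∑ᶠ e ∈ p ⁻¹' {x}, h e) = 1) ∧
      (∀ K : Set X, IsCompact K →
        IsCompact (p ⁻¹' K ∩ closure {e : E | h e ≠ 0})) := by
  classical
  have hpc : Continuous p := hp.continuous
  choose c hc using hpsurj
  choose φ hφc hφ using fun x ↦ hp.isLocalHomeomorph (c x)
  have hφp : ∀ x e, φ x e = p e := fun x e ↦ by rw [← hφ x]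
  have hsymm : ∀ i, ∀ x ∈ (φ i).target, p ((φ i).symm x) = x := fun i x hx ↦ by
    rw [← hφp i, (φ i).right_inv hx]
  have hmem : ∀ x, x ∈ (φ x).target := fun x ↦ by
    simpa [hφp, hc] using (φ x).map_source (hφc x)
  choose L hLc hxL hLt using fun x ↦ exists_compact_subset (φ x).open_target (hmem x)
  obtain ⟨ρ, hρ⟩ := PartitionOfUnity.exists_isSubordinate isClosed_univ
    (fun x ↦ interior (L x)) (fun _ ↦ isOpen_interior)
    (fun x _ ↦ Set.mem_iUnion.2 ⟨x, hxL x⟩)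
  have hρL : ∀ i, tsupport (ρ i) ⊆ L i := fun i ↦ (hρ i).trans interior_subset
  have hρt : ∀ i, tsupport (ρ i) ⊆ (φ i).target := fun i ↦ (hρL i).trans (hLt i)
  have hρc : ∀ i, IsCompact (tsupport (ρ i)) := fun i ↦
    (hLc i).of_isClosed_subset (isClosed_tsupport _) (hρL i)
  let g : X → E → ℝ := fun i ↦ sheetLift (φ i) (ρ i)
  let C : X → Set E := fun i ↦ (φ i).symm '' tsupport (ρ i)
  have hC : ∀ i, IsCompact (C i) := fun i ↦
    isCompact_symm_image (φ i) (hρc i) (hρt i)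
  have hCp : ∀ i, C i ⊆ p ⁻¹' tsupport (ρ i) := by
    rintro i _ ⟨x, hx, rfl⟩
    simpa [hsymm i x (hρt i hx)] using hx
  have hCfin : LocallyFinite C :=
    (ρ.locallyFinite_tsupport.preimage_continuous hpc).subset hCp
  have hgC : ∀ i, Function.support (g i) ⊆ C i := fun i ↦ support_sheetLift_subset _ _
  have hgfin : LocallyFinite fun i ↦ Function.support (g i) := hCfin.subset hgC
  have hgc : ∀ i, Continuous (g i) := fun i ↦
    continuous_sheetLift (φ i) (ρ i).continuous (hρc i) (hρt i)
  have hg0 : ∀ i e, 0 ≤ g i e := fun i e ↦ sheetLift_nonneg _ (ρ.nonneg i) e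
  have hgρ : ∀ i e, g i e ≤ ρ i (p e) := fun i e ↦ by
    rw [← hφp i]
    exact sheetLift_le _ (ρ.nonneg i) e
  have hgne : ∀ i e, g i e ≠ 0 → ρ i (p e) ≠ 0 := fun i e h ↦
    ((lt_of_le_of_ne (hg0 i e) h.symm).trans_le (hgρ i e)).ne'
  have hsum : ∀ e, ∑ᶠ i, g i e = ∑ i ∈ ρ.finsupport (p e), g i e := fun e ↦
    finsum_eq_sum_of_support_subset _ fun i hi ↦ by
      rw [ρ.coe_finsupport]
      exact hgne i e hi
  have hex : ∀ e, ∑ᶠ i, g i e ≠ 0 → ∃ i, g i e ≠ 0 := fun e he ↦ by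
    contrapose! he
    simp [he]
  have hsupp : {e | ∑ᶠ i, g i e ≠ 0} ⊆ ⋃ i, C i := fun e he ↦ by
    obtain ⟨i, hi⟩ := hex e he
    exact Set.mem_iUnion.2 ⟨i, hgC i hi⟩
  refine ⟨fun e ↦ ∑ᶠ i, g i e, continuous_finsum hgc hgfin, fun e ↦ ⟨?_, ?_⟩, fun x ↦ ?_,
    fun K hK ↦ ?_⟩
  · exact finsum_nonneg fun i ↦ hg0 i e
  · refine (hsum e).trans_le ?_
    rw [← ρ.sum_finsupport (Set.mem_univ (p e))]
    exact Finset.sum_le_sum fun i _ ↦ hgρ i e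
  · have hTt : ∀ i ∈ ρ.finsupport x, x ∈ (φ i).target := fun i hi ↦
      hρt i (subset_tsupport _ ((ρ.mem_finsupport x).1 hi))
    have hsub : {e ∈ p ⁻¹' {x} | ∑ᶠ i, g i e ≠ 0} ⊆
        ((ρ.finsupport x).image fun i ↦ (φ i).symm x : Finset E) := by
      rintro e ⟨rfl, he⟩
      obtain ⟨i, hi⟩ := hex _ he
      refine Finset.mem_coe.2 (Finset.mem_image.2
        ⟨i, (ρ.mem_finsupport _).2 (hgne i e hi), ?_⟩)
      rw [← hφp i]
      exact (φ i).left_inv (mem_source_of_sheetLift_ne_zero hi)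
    refine ⟨(Finset.finite_toSet _).subset hsub, ?_⟩
    have hT : ∀ e ∈ (ρ.finsupport x).image fun i ↦ (φ i).symm x, p e = x := by
      intro e he
      obtain ⟨i, hi, rfl⟩ := Finset.mem_image.1 he
      exact hsymm i x (hTt i hi)
    rw [finsum_mem_eq_sum_of_inter_support_eq (t := (ρ.finsupport x).image fun i ↦ (φ i).symm x),
      Finset.sum_congr rfl fun e he ↦ by rw [hsum e, hT e he], Finset.sum_comm,
      ← ρ.sum_finsupport (Set.mem_univ x)]
    · refine Finset.sum_congr rfl fun i hi ↦ ?_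
      rw [Finset.sum_eq_single ((φ i).symm x)]
      · exact sheetLift_symm_apply _ _ (hTt i hi)
      · intro e he hne
        by_contra h
        refine hne ?_
        rw [← hT e he, ← hφp i]
        exact ((φ i).left_inv (mem_source_of_sheetLift_ne_zero h)).symm
      · exact fun h ↦ (h (Finset.mem_image_of_mem _ hi)).elim
    · ext e
      exact ⟨fun h ↦ ⟨hsub h, h.2⟩, fun h ↦ ⟨hT e h.1, h.2⟩⟩
  · have hfin := ρ.locallyFinite_tsupport.finite_nonempty_inter_compact hK
    refine (hfin.isCompact_biUnion fun i _ ↦ hC i).of_isClosed_subset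
      ((hK.isClosed.preimage hpc).inter isClosed_closure) ?_
    rintro e ⟨heK, he⟩
    obtain ⟨i, hi⟩ := Set.mem_iUnion.1
      (closure_minimal hsupp (hCfin.isClosed_iUnion fun i ↦ (hC i).isClosed) he)
    exact Set.mem_biUnion (show i ∈ {i | (tsupport (ρ i) ∩ K).Nonempty} from
      ⟨p e, hCp i hi, heK⟩) hi
end

section
/- Let p : E → X be a covering map, where E is connected and locally compact Hausdorff, X is locally compact, Hausdorff and paracompact, and the group of deck transformations of p acts transitively on each fibre of p. Let λ be a fully supported Radon measure on E that is invariant under every deck transformation of p. Then there exists a fully supported Radon measure ν on X such that for every continuous compactly supported f : E → ℝ, ∫_E f dλ = ∫_X (∑_{e ∈ p⁻¹(x)} f(e)) dν(x). -/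
open MeasureTheory
open scoped BigOperators

/-- A (positive) Radon measure: a Borel measure that is finite on compact sets, outer
regular, and inner regular with respect to compact sets. -/
def IsRadonMeasure {α : Type*} [TopologicalSpace α] [MeasurableSpace α]
    (μ : Measure α) : Prop :=
  IsFiniteMeasureOnCompacts μ ∧ μ.OuterRegular ∧ μ.InnerRegular

open Set Filter Topology
open scoped CompactlySupported

/-- A connected, locally compact, paracompact space is `σ`-compact. -/
theorem SigmaCompactSpace.of_paracompactSpace_of_connectedSpace (X : Type*) [TopologicalSpace X]
    [LocallyCompactSpace X] [R1Space X] [ParacompactSpace X] [ConnectedSpace X] :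
    SigmaCompactSpace X := by
  choose N hN hxN using fun x : X ↦ exists_compact_mem_nhds x
  obtain ⟨U, hUo, hUc, hUf, hUN⟩ := precise_refinement (fun x ↦ interior (N x))
    (fun _ ↦ isOpen_interior) (iUnion_eq_univ_iff.2 fun x ↦ ⟨x, mem_interior_iff_mem_nhds.2 (hxN x)⟩)
  have hcl (i : X) : IsCompact (closure (U i)) :=
    (hN i).closure_of_subset ((hUN i).trans interior_subset)
  have step (K : {K : Set X // IsCompact K}) : ∃ L : {K : Set X // IsCompact K},
      ∀ i, (U i ∩ K.1).Nonempty → U i ⊆ L.1 :=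
    ⟨⟨⋃ i ∈ {i | (U i ∩ K.1).Nonempty}, closure (U i),
      (hUf.finite_nonempty_inter_compact K.2).isCompact_biUnion fun i _ ↦ hcl i⟩,
      fun i hi ↦ subset_closure.trans (subset_biUnion_of_mem (u := fun i ↦ closure (U i)) hi)⟩
  choose next hnext using step
  obtain ⟨x₀⟩ : Nonempty X := inferInstance
  let K : ℕ → {K : Set X // IsCompact K} := fun n ↦ next^[n] ⟨{x₀}, isCompact_singleton⟩
  have hK (n : ℕ) (i : X) (hi : (U i ∩ (K n).1).Nonempty) : U i ⊆ (K (n + 1)).1 := by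
    simp only [K, Function.iterate_succ_apply']
    exact hnext _ i hi
  have hclopen : IsClopen (⋃ n, (K n).1) := by
    refine ⟨isClosed_of_closure_subset fun x hx ↦ ?_, isOpen_iff_mem_nhds.2 fun x hx ↦ ?_⟩
    · obtain ⟨i, hi⟩ := iUnion_eq_univ_iff.1 hUc x
      obtain ⟨y, hyU, hy⟩ := mem_closure_iff_nhds.1 hx _ ((hUo i).mem_nhds hi)
      obtain ⟨n, hn⟩ := mem_iUnion.1 hy
      exact mem_iUnion.2 ⟨n + 1, hK n i ⟨y, hyU, hn⟩ hi⟩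
    · obtain ⟨i, hi⟩ := iUnion_eq_univ_iff.1 hUc x
      obtain ⟨n, hn⟩ := mem_iUnion.1 hx
      exact mem_of_superset ((hUo i).mem_nhds hi)
        ((hK n i ⟨x, hi, hn⟩).trans (subset_iUnion (fun n ↦ (K n).1) (n + 1)))
  exact ⟨⟨fun n ↦ (K n).1, fun n ↦ (K n).2,
    hclopen.eq_univ ⟨x₀, mem_iUnion.2 ⟨0, mem_singleton x₀⟩⟩⟩⟩

section Deck

variable {E X : Type*} {p : E → X}

/-- The sum of `f` over the fibres of `p`. -/
noncomputable def fiberSum (p : E → X) (f : E → ℝ) (x : X) : ℝ := ∑ᶠ e ∈ p ⁻¹' {x}, f e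

theorem fiberSum_mul_comp (f : E → ℝ) (g : X → ℝ) (x : X) :
    fiberSum p (fun e ↦ f e * g (p e)) x = fiberSum p f x * g x := by
  rw [fiberSum, fiberSum, mul_comm, mul_finsum_mem]
  exact finsum_mem_congr rfl fun e he ↦ by rw [mul_comm, show p e = x from he]

theorem fiberSum_nonneg {f : E → ℝ} (hf : ∀ e, 0 ≤ f e) (x : X) : 0 ≤ fiberSum p f x :=
  finsum_nonneg fun e ↦ finsum_nonneg fun _ ↦ hf e

theorem fiberSum_eq_zero_of_notMem_image {f : E → ℝ} {K : Set E} (hK : Function.support f ⊆ K)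
    {x : X} (hx : x ∉ p '' K) : fiberSum p f x = 0 :=
  finsum_mem_eq_zero_of_forall_eq_zero fun e he ↦ by
    by_contra h
    exact hx ⟨e, hK h, he⟩

variable [TopologicalSpace E]

/-- The deck transformations of `p`. -/
abbrev DeckTransformation (p : E → X) : Type _ := {φ : E ≃ₜ E // p ∘ φ = p}

namespace DeckTransformation

/-- The inverse of a deck transformation. -/
def symm (γ : DeckTransformation p) : DeckTransformation p :=
  ⟨γ.1.symm, funext fun e ↦ by simpa using (congrFun γ.2 (γ.1.symm e)).symm⟩

theorem proj_apply (γ : DeckTransformation p) (e : E) : p (γ.1 e) = p e := congrFun γ.2 e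

theorem symm_bijective : Function.Bijective (symm (p := p)) :=
  Function.Involutive.bijective fun _ ↦ Subtype.ext (Homeomorph.symm_symm _)

variable [TopologicalSpace X]

theorem eq_of_apply_eq [PreconnectedSpace E] (hp : IsCoveringMap p) {γ γ' : DeckTransformation p}
    {e : E} (h : γ.1 e = γ'.1 e) : γ = γ' :=
  Subtype.ext <| Homeomorph.ext <| congrFun <|
    hp.eq_of_comp_eq γ.1.continuous γ'.1.continuous (γ.2.trans γ'.2.symm) e h

/-- The deck transformations of a connected covering act properly discontinuously if they are
transitive on the fibres. -/
theorem finite_setOf_exists_mem_of_isCompact [PreconnectedSpace E] [T2Space X] (hp : IsCoveringMap p)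
    (hdeck : ∀ e e' : E, p e = p e' → ∃ φ : E ≃ₜ E, p ∘ φ = p ∧ φ e = e')
    {K L : Set E} (hK : IsCompact K) (hL : IsCompact L) :
    {γ : DeckTransformation p | ∃ e ∈ K, γ.1 e ∈ L}.Finite := by
  suffices {γ : DeckTransformation p | ∃ e, (e, γ.1 e) ∈ K ×ˢ L}.Finite by
    simpa only [mem_prod] using this
  refine (hK.prod hL).induction_on
    (p := fun s ↦ {γ : DeckTransformation p | ∃ e, (e, γ.1 e) ∈ s}.Finite)
    (by simp) (fun s t hst ht ↦ ht.subset fun γ ⟨e, he⟩ ↦ ⟨e, hst he⟩)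
    (fun s t hs ht ↦ (hs.union ht).subset ?_) ?_
  · rintro γ ⟨e, he | he⟩
    exacts [Or.inl ⟨e, he⟩, Or.inr ⟨e, he⟩]
  rintro ⟨e, e'⟩ -
  by_cases h : p e = p e'
  · obtain ⟨φ, hφ, rfl⟩ := hdeck e e' h
    obtain ⟨V, hVo, heV, hV⟩ := hp.isLocalHomeomorph.isLocallyInjective (φ e)
    refine ⟨(φ ⁻¹' V) ×ˢ V, mem_nhdsWithin_of_mem_nhds (prod_mem_nhds
      ((hVo.preimage φ.continuous).mem_nhds heV) (hVo.mem_nhds heV)),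
      (finite_singleton (⟨φ, hφ⟩ : DeckTransformation p)).subset ?_⟩
    rintro γ ⟨y, hy⟩
    exact eq_of_apply_eq hp
      (hV hy.2 hy.1 ((DeckTransformation.proj_apply γ y).trans (congrFun hφ y).symm))
  · obtain ⟨A, B, hA, hB, heA, heB, hAB⟩ := t2_separation h
    refine ⟨(p ⁻¹' A) ×ˢ (p ⁻¹' B), mem_nhdsWithin_of_mem_nhds (prod_mem_nhds
      ((hA.preimage hp.continuous).mem_nhds heA) ((hB.preimage hp.continuous).mem_nhds heB)), ?_⟩
    refine finite_empty.subset ?_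
    rintro γ ⟨y, hyA, hyB⟩
    exact disjoint_left.1 hAB hyA (by simpa [DeckTransformation.proj_apply γ] using hyB)

end DeckTransformation

variable [TopologicalSpace X]

theorem fiberSum_apply_proj [PreconnectedSpace E] (hp : IsCoveringMap p)
    (hdeck : ∀ e e' : E, p e = p e' → ∃ φ : E ≃ₜ E, p ∘ φ = p ∧ φ e = e') (f : E → ℝ) (e : E) :
    fiberSum p f (p e) = ∑ᶠ γ : DeckTransformation p, f (γ.1 e) := by
  have hrange : p ⁻¹' {p e} = range fun γ : DeckTransformation p ↦ γ.1 e := by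
    ext e'
    constructor
    · intro he'
      obtain ⟨φ, hφ, h⟩ := hdeck e e' (mem_singleton_iff.1 he').symm
      exact ⟨⟨φ, hφ⟩, h⟩
    · rintro ⟨γ, rfl⟩
      exact γ.proj_apply e
  rw [fiberSum, hrange,
    finsum_mem_range fun γ γ' h ↦ DeckTransformation.eq_of_apply_eq hp h]

theorem hasCompactSupport_fiberSum [R1Space X] (hp : IsCoveringMap p) {f : E → ℝ}
    (hf : HasCompactSupport f) : HasCompactSupport (fiberSum p f) :=
  .intro (hf.isCompact.image hp.continuous) fun _ ↦
    fiberSum_eq_zero_of_notMem_image (subset_tsupport f)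

theorem continuous_fiberSum [PreconnectedSpace E] [LocallyCompactSpace E] [T2Space X]
    (hp : IsCoveringMap p) (hpsurj : Function.Surjective p)
    (hdeck : ∀ e e' : E, p e = p e' → ∃ φ : E ≃ₜ E, p ∘ φ = p ∧ φ e = e')
    {f : E → ℝ} (hf : Continuous f) (hfc : HasCompactSupport f) : Continuous (fiberSum p f) := by
  rw [(hp.isQuotientMap hpsurj).continuous_iff,
    show fiberSum p f ∘ p = fun e ↦ ∑ᶠ γ : DeckTransformation p, f (γ.1 e) from
      funext (fiberSum_apply_proj hp hdeck f)]
  refine continuous_finsum (fun γ ↦ hf.comp γ.1.continuous) fun e ↦ ?_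
  obtain ⟨N, hN, heN⟩ := exists_compact_mem_nhds e
  refine ⟨N, heN,
    (DeckTransformation.finite_setOf_exists_mem_of_isCompact hp hdeck hN hfc.isCompact).subset ?_⟩
  rintro γ ⟨y, hy, hyN⟩
  exact ⟨y, hyN, subset_tsupport f hy⟩

theorem IsOpenMap.exists_isCompact_subset_image [LocallyCompactSpace E] (hp : IsOpenMap p)
    (hpsurj : Function.Surjective p) {C : Set X} (hC : IsCompact C) :
    ∃ K : Set E, IsCompact K ∧ C ⊆ p '' K := by
  choose N hN hxN using fun e : E ↦ exists_compact_mem_nhds e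
  choose s hs using hpsurj
  obtain ⟨t, -, ht⟩ := hC.elim_nhds_subcover (fun x ↦ p '' N (s x)) fun x _ ↦ by
    simpa only [hs] using hp.image_mem_nhds (hxN (s x))
  refine ⟨⋃ x ∈ t, N (s x), t.isCompact_biUnion fun x _ ↦ hN _, ?_⟩
  simpa only [image_iUnion] using ht

/-- Every compact set of the base carries a nonnegative compactly supported function upstairs whose
fibre sums over it are equal to `1`. -/
theorem exists_fiberSum_eq_one [PreconnectedSpace E] [LocallyCompactSpace E] [T2Space E]
    [T2Space X] (hp : IsCoveringMap p) (hpsurj : Function.Surjective p)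
    (hdeck : ∀ e e' : E, p e = p e' → ∃ φ : E ≃ₜ E, p ∘ φ = p ∧ φ e = e')
    {C : Set X} (hC : IsCompact C) :
    ∃ ψ : E → ℝ, Continuous ψ ∧ HasCompactSupport ψ ∧ (∀ e, 0 ≤ ψ e) ∧
      ∀ x ∈ C, fiberSum p ψ x = 1 := by
  obtain ⟨K, hK, hCK⟩ := hp.isOpenMap.exists_isCompact_subset_image hpsurj hC
  obtain ⟨u, huK, -, huc, hu⟩ := exists_continuous_one_zero_of_isCompact hK isClosed_empty
    (disjoint_empty K)
  have hcont := continuous_fiberSum hp hpsurj hdeck u.continuous huc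
  refine ⟨fun e ↦ u e * (max (fiberSum p u (p e)) 1)⁻¹, ?_, huc.mul_right,
    fun e ↦ mul_nonneg (hu e).1 (by positivity), fun x hx ↦ ?_⟩
  · exact u.continuous.mul (((hcont.comp hp.continuous).max continuous_const).inv₀
      fun e ↦ (zero_lt_one.trans_le (le_max_right _ _)).ne')
  obtain ⟨e, heK, rfl⟩ := hCK hx
  have hone : 1 ≤ fiberSum p u (p e) := by
    rw [fiberSum_apply_proj hp hdeck]
    have hfin : (Function.support fun γ : DeckTransformation p ↦ u (γ.1 e)).Finite :=
      (DeckTransformation.finite_setOf_exists_mem_of_isCompact hp hdeck (isCompact_singleton (x := e))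
        huc.isCompact).subset fun γ hγ ↦ ⟨e, rfl, subset_tsupport u hγ⟩
    have hle := single_le_finsum (⟨Homeomorph.refl E, rfl⟩ : DeckTransformation p) hfin
      fun γ ↦ (hu (γ.1 e)).1
    exact (huK heK).ge.trans hle
  rw [fiberSum_mul_comp u (fun x ↦ (max (fiberSum p u x) 1)⁻¹), max_eq_left hone,
    mul_inv_cancel₀ (zero_lt_one.trans_le hone).ne']

/-- Unfolding: summing over the fibres is self-adjoint with respect to an invariant measure. -/
theorem integral_mul_fiberSum_comm [PreconnectedSpace E] [T2Space X]
    [MeasurableSpace E] [BorelSpace E] (hp : IsCoveringMap p)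
    (hdeck : ∀ e e' : E, p e = p e' → ∃ φ : E ≃ₜ E, p ∘ φ = p ∧ φ e = e')
    {lam : Measure E} [IsFiniteMeasureOnCompacts lam]
    (hlaminv : ∀ φ : E ≃ₜ E, p ∘ φ = p → Measure.map φ lam = lam)
    {f g : E → ℝ} (hf : Continuous f) (hfc : HasCompactSupport f)
    (hg : Continuous g) (hgc : HasCompactSupport g) :
    ∫ e, f e * fiberSum p g (p e) ∂lam = ∫ e, g e * fiberSum p f (p e) ∂lam := by
  have expand {f g : E → ℝ} (hf : Continuous f) (hfc : HasCompactSupport f)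
      (hg : Continuous g) (hgc : HasCompactSupport g) :
      ∫ e, f e * fiberSum p g (p e) ∂lam =
        ∑ᶠ γ : DeckTransformation p, ∫ e, f e * g (γ.1 e) ∂lam := by
    have hfin := DeckTransformation.finite_setOf_exists_mem_of_isCompact hp hdeck hfc.isCompact
      hgc.isCompact
    have hmem {γ : DeckTransformation p} {e : E} (h : f e * g (γ.1 e) ≠ 0) :
        γ ∈ hfin.toFinset :=
      hfin.mem_toFinset.2 ⟨e, subset_tsupport f (left_ne_zero_of_mul h),
        subset_tsupport g (right_ne_zero_of_mul h)⟩
    have hpt (e : E) : f e * fiberSum p g (p e) = ∑ γ ∈ hfin.toFinset, f e * g (γ.1 e) := by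
      rw [fiberSum_apply_proj hp hdeck, mul_finsum]
      exact finsum_eq_sum_of_support_subset _ fun γ hγ ↦ hmem hγ
    simp_rw [hpt]
    have hint (γ : DeckTransformation p) : Integrable (fun e ↦ f e * g (γ.1 e)) lam :=
      (hf.mul (hg.comp γ.1.continuous)).integrable_of_hasCompactSupport hfc.mul_right
    rw [integral_finsetSum _ fun γ _ ↦ hint γ]
    refine (finsum_eq_sum_of_support_subset _ fun γ hγ ↦ ?_).symm
    by_contra h
    refine hγ (integral_eq_zero_of_ae (.of_forall fun e ↦ ?_))
    by_contra h'
    exact h (hmem h')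
  rw [expand hf hfc hg hgc, expand hg hgc hf hfc]
  refine finsum_eq_of_bijective DeckTransformation.symm DeckTransformation.symm_bijective fun γ ↦ ?_
  conv_rhs => rw [← hlaminv γ.1 γ.2]
  rw [γ.1.measurableEmbedding.integral_map]
  simp [DeckTransformation.symm, mul_comm]

end Deck

/-- Let `p : E → X` be a covering map with `E` connected, locally compact and
Hausdorff, `X` locally compact Hausdorff paracompact, whose deck transformation group acts
transitively on fibres. If `λ` is a fully supported Radon measure on `E` invariant under all
deck transformations, then there is a fully supported Radon measure `ν` on `X` with
`∫ f dλ = ∫ (∑_{e ∈ p⁻¹(x)} f e) dν(x)` for every continuous compactly supported `f`. -/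
theorem exists_pushdown_measure_of_deck_invariant
    {E X : Type*} [TopologicalSpace E] [LocallyCompactSpace E] [T2Space E]
    [ConnectedSpace E]
    [TopologicalSpace X] [LocallyCompactSpace X] [T2Space X] [ParacompactSpace X]
    [MeasurableSpace E] [BorelSpace E] [MeasurableSpace X] [BorelSpace X]
    {p : E → X} (hp : IsCoveringMap p) (hpsurj : Function.Surjective p)
    (hdeck : ∀ e e' : E, p e = p e' → ∃ φ : E ≃ₜ E, p ∘ φ = p ∧ φ e = e')
    (lam : Measure E) (hlamRadon : IsRadonMeasure lam)
    (hlamfull : ∀ U : Set E, IsOpen U → U.Nonempty → 0 < lam U)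
    (hlaminv : ∀ φ : E ≃ₜ E, p ∘ φ = p → Measure.map φ lam = lam) :
    ∃ ν : Measure X, IsRadonMeasure ν ∧
      (∀ U : Set X, IsOpen U → U.Nonempty → 0 < ν U) ∧
      (∀ f : E → ℝ, Continuous f → HasCompactSupport f →
        ∫ e, f e ∂lam = ∫ x, (∑ᶠ e ∈ p ⁻¹' {x}, f e) ∂ν) := by
  have := hlamRadon.1
  have : lam.IsOpenPosMeasure := ⟨fun U hU hne ↦ (hlamfull U hU hne).ne'⟩
  have : ConnectedSpace X := hpsurj.connectedSpace hp.continuous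
  have := SigmaCompactSpace.of_paracompactSpace_of_connectedSpace X
  choose ψ hψ hψc hψ0 hψ1 using fun C : {C : Set X // IsCompact C} ↦
    exists_fiberSum_eq_one hp hpsurj hdeck C.2
  have hsupp (g : C_c(X, ℝ)) : IsCompact (tsupport g) := g.hasCompactSupport
  have hint (g : C_c(X, ℝ)) (C : {C : Set X // IsCompact C}) :
      Integrable (fun e ↦ ψ C e * g (p e)) lam :=
    ((hψ C).mul (g.continuous.comp hp.continuous)).integrable_of_hasCompactSupport
      (hψc C).mul_right
  have hindep (g : C_c(X, ℝ)) {C D : {C : Set X // IsCompact C}} (hC : tsupport g ⊆ C.1)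
      (hD : tsupport g ⊆ D.1) :
      ∫ e, ψ C e * g (p e) ∂lam = ∫ e, ψ D e * g (p e) ∂lam := by
    have hmul {C : {C : Set X // IsCompact C}} (hC : tsupport g ⊆ C.1) (x : X) :
        fiberSum p (ψ C) x * g x = g x := by
      by_cases hx : x ∈ tsupport g
      · rw [hψ1 C x (hC hx), one_mul]
      · rw [image_eq_zero_of_notMem_tsupport hx, mul_zero]
    have h := integral_mul_fiberSum_comm (f := fun e ↦ ψ C e * g (p e)) hp hdeck hlaminv
      ((hψ C).mul (g.continuous.comp hp.continuous)) (hψc C).mul_right (hψ D) (hψc D)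
    simpa only [fiberSum_mul_comp (ψ C) g, hmul hC, mul_assoc,
      mul_comm (g _), hmul hD] using h
  let Λ₀ : C_c(X, ℝ) →ₗ[ℝ] ℝ :=
    { toFun := fun g ↦ ∫ e, ψ ⟨tsupport g, hsupp g⟩ e * g (p e) ∂lam
      map_add' := fun g h ↦ by
        let C : {C : Set X // IsCompact C} := ⟨tsupport g ∪ tsupport h, (hsupp g).union (hsupp h)⟩
        rw [hindep (g + h) (C := ⟨_, hsupp (g + h)⟩) (D := C) subset_rfl (tsupport_add g h),
          hindep g (C := ⟨_, hsupp g⟩) (D := C) subset_rfl subset_union_left,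
          hindep h (C := ⟨_, hsupp h⟩) (D := C) subset_rfl subset_union_right,
          ← integral_add (hint g C) (hint h C)]
        simp [mul_add]
      map_smul' := fun c g ↦ by
        rw [hindep (c • g) (C := ⟨_, hsupp (c • g)⟩) (D := ⟨_, hsupp g⟩) subset_rfl
          (tsupport_smul_subset_right (fun _ ↦ c) g), RingHom.id_apply, smul_eq_mul,
          ← integral_const_mul]
        simp [mul_left_comm] }
  let Λ : C_c(X, ℝ) →ₚ[ℝ] ℝ := .mk₀ Λ₀ fun g hg ↦
    integral_nonneg fun e ↦ mul_nonneg (hψ0 _ e) (hg (p e))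
  have hΛ (g : C_c(X, ℝ)) : ∫ x, g x ∂(RealRMK.rieszMeasure Λ) =
      ∫ e, ψ ⟨tsupport g, hsupp g⟩ e * g (p e) ∂lam := RealRMK.integral_rieszMeasure Λ g
  refine ⟨RealRMK.rieszMeasure Λ, ⟨inferInstance, inferInstance, inferInstance⟩,
    fun U hU ⟨x, hx⟩ ↦ ?_, fun f hf hfc ↦ ?_⟩
  · obtain ⟨u, hux, huc, huU, hu⟩ := exists_continuousMap_one_of_isCompact_subset_isOpen
      (isCompact_singleton (x := x)) hU (singleton_subset_iff.2 hx)
    have hux : u x = 1 := hux rfl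
    let g : C_c(X, ℝ) := ⟨u, huc⟩
    have hgx : g x = 1 := hux
    have hxg : x ∈ tsupport g := subset_tsupport _ (by simp [hgx])
    obtain ⟨e, he, hne⟩ : ∃ e ∈ p ⁻¹' {x}, ψ ⟨tsupport g, hsupp g⟩ e ≠ 0 := by
      by_contra! h
      exact zero_ne_one ((finsum_mem_eq_zero_of_forall_eq_zero h).symm.trans (hψ1 _ x hxg))
    have hpos : 0 < ∫ e, ψ ⟨tsupport g, hsupp g⟩ e * g (p e) ∂lam :=
      ((hψ _).mul (g.continuous.comp hp.continuous)).integral_pos_of_hasCompactSupport_nonneg_nonzero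
        (hψc _).mul_right (fun e ↦ mul_nonneg (hψ0 _ e) (hu (p e)).1) (x := e)
        (mul_ne_zero hne (by simp [show p e = x from he, hgx]))
    rw [← hΛ g] at hpos
    refine pos_iff_ne_zero.2 fun hzero ↦ hpos.ne' (integral_eq_zero_of_ae ?_)
    filter_upwards [measure_eq_zero_iff_ae_notMem.1 hzero] with y hy
    exact image_eq_zero_of_notMem_tsupport fun h ↦ hy (huU h)
  · let g : C_c(X, ℝ) :=
      ⟨⟨fiberSum p f, continuous_fiberSum hp hpsurj hdeck hf hfc⟩, hasCompactSupport_fiberSum hp hfc⟩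
    let C : {C : Set X // IsCompact C} := ⟨p '' tsupport f, hfc.isCompact.image hp.continuous⟩
    have hgC : tsupport g ⊆ C.1 := closure_minimal (fun x hx ↦ by
      by_contra h
      exact hx (fiberSum_eq_zero_of_notMem_image (subset_tsupport f) h)) C.2.isClosed
    calc ∫ e, f e ∂lam = ∫ e, f e * fiberSum p (ψ C) (p e) ∂lam := by
          refine integral_congr_ae (.of_forall fun e ↦ ?_)
          by_cases he : e ∈ tsupport f
          · simp [hψ1 C (p e) ⟨e, he, rfl⟩]
          · simp [image_eq_zero_of_notMem_tsupport he]
      _ = ∫ e, ψ C e * g (p e) ∂lam :=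
          integral_mul_fiberSum_comm hp hdeck hlaminv hf hfc (hψ C) (hψc C)
      _ = ∫ x, g x ∂(RealRMK.rieszMeasure Λ) := by
          rw [hΛ g]
          exact hindep g hgC subset_rfl
end

section
/- Let X and Y be locally compact Hausdorff topological spaces and let π : X → Y be a surjective local homeomorphism. If ν₁ and ν₂ are Radon measures on Y such that for every continuous compactly supported f : X → ℝ one has ∫_Y (∑_{x ∈ π⁻¹(y)} f(x)) dν₁(y) = ∫_Y (∑_{x ∈ π⁻¹(y)} f(x)) dν₂(y), then ν₁ = ν₂. -/
open MeasureTheory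
open scoped BigOperators

theorem IsRadonMeasure.regular {α : Type*} [TopologicalSpace α] [MeasurableSpace α]
    [OpensMeasurableSpace α] {μ : Measure α} (h : IsRadonMeasure μ) : μ.Regular :=
  { toIsFiniteMeasureOnCompacts := h.1
    toOuterRegular := h.2.1
    innerRegular := fun _ hU r hr => h.2.2.innerRegular hU.measurableSet r hr }

/-- A compactly supported continuous function whose support lies in the target of a chart of `π`
is the fibrewise sum of a compactly supported continuous function. -/
theorem OpenPartialHomeomorph.exists_finsum_fiber_eq {X Y : Type*} [TopologicalSpace X]
    [TopologicalSpace Y] [T2Space X] (e : OpenPartialHomeomorph X Y) {g : Y → ℝ}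
    (hg : Continuous g) (hgc : HasCompactSupport g) (hge : tsupport g ⊆ e.target)
    {π : X → Y} (hπ : π = e) :
    ∃ f : X → ℝ, Continuous f ∧ HasCompactSupport f ∧
      ∀ y, ∑ᶠ x ∈ π ⁻¹' {y}, f x = g y := by
  subst hπ
  have hK : IsCompact (e.symm '' tsupport g) :=
    hgc.isCompact.image_of_continuousOn (e.continuousOn_symm.mono hge)
  have hzero : ∀ x, x ∉ e.symm '' tsupport g → e.source.indicator (g ∘ e) x = 0 := by
    intro x hx
    by_cases hxs : x ∈ e.source
    · rw [Set.indicator_of_mem hxs]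
      exact image_eq_zero_of_notMem_tsupport (f := g) fun hgx => hx ⟨e x, hgx, e.left_inv hxs⟩
    · exact Set.indicator_of_notMem hxs _
  refine ⟨e.source.indicator (g ∘ e), ?_, HasCompactSupport.intro hK hzero, fun y => ?_⟩
  · refine continuous_iff_continuousAt.2 fun x => ?_
    by_cases hxs : x ∈ e.source
    · refine (hg.continuousAt.comp (e.continuousAt hxs)).congr ?_
      filter_upwards [e.open_source.mem_nhds hxs] with z hz
      rw [Set.indicator_of_mem hz]
    · have hxK : x ∉ e.symm '' tsupport g := by
        rintro ⟨y, hy, rfl⟩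
        exact hxs (e.map_target (hge hy))
      refine (continuousAt_const (y := (0 : ℝ))).congr ?_
      filter_upwards [hK.isClosed.isOpen_compl.mem_nhds hxK] with z hz
      exact (hzero z hz).symm
  · by_cases hy : y ∈ e.target
    · rw [finsum_eq_single _ (e.symm y)]
      · simp [hy]
      · intro x hx
        by_cases hxs : x ∈ e.source
        · have : x ∉ e ⁻¹' {y} := by
            rintro rfl
            exact hx (e.left_inv hxs).symm
          simp [this]
        · simp [hxs]
    · rw [image_eq_zero_of_notMem_tsupport fun h => hy (hge h)]
      refine finsum_mem_eq_zero_of_forall_eq_zero ?_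
      rintro x rfl
      exact Set.indicator_of_notMem (fun hx => hy (e.map_source hx)) _

/-- Let `π : X → Y` be a surjective local homeomorphism between locally compact
Hausdorff spaces. If two Radon measures `ν₁, ν₂` on `Y` integrate all fibrewise sums of
continuous compactly supported functions on `X` equally, then `ν₁ = ν₂`. -/
theorem pushdown_measure_unique
    {X Y : Type*} [TopologicalSpace X] [TopologicalSpace Y]
    [MeasurableSpace Y] [BorelSpace Y]
    [LocallyCompactSpace X] [T2Space X] [LocallyCompactSpace Y] [T2Space Y]
    {π : X → Y} (hπ : IsLocalHomeomorph π) (hπsurj : Function.Surjective π)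
    (ν₁ ν₂ : Measure Y) (hν₁ : IsRadonMeasure ν₁) (hν₂ : IsRadonMeasure ν₂)
    (h : ∀ f : X → ℝ, Continuous f → HasCompactSupport f →
      ∫ y, (∑ᶠ x ∈ π ⁻¹' {y}, f x) ∂ν₁ = ∫ y, (∑ᶠ x ∈ π ⁻¹' {y}, f x) ∂ν₂) :
    ν₁ = ν₂ := by
  have := hν₁.regular
  have := hν₂.regular
  refine Measure.ext_of_integral_eq_on_compactlySupported fun g => ?_
  choose x hx using hπsurj
  choose e hxe he using hπ
  have hcover : tsupport g ⊆ ⋃ y, (e (x y)).target := fun y _ => Set.mem_iUnion.2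
    ⟨y, by simpa [← he, hx] using (e (x y)).map_source (hxe (x y))⟩
  obtain ⟨t, ht⟩ := g.hasCompactSupport.isCompact.elim_finite_subcover _
    (fun y => (e (x y)).open_target) hcover
  obtain ⟨p, hpt, hp1, -, -⟩ := exists_continuous_sum_one_of_isOpen_isCompact
    (s := fun i => (e (x (t.equivFin.symm i))).target)
    (fun i => (e (x (t.equivFin.symm i))).open_target) g.hasCompactSupport.isCompact (by
      intro y hy
      obtain ⟨z, hz, hyz⟩ := Set.mem_iUnion₂.1 (ht hy)
      exact Set.mem_iUnion.2 ⟨t.equivFin ⟨z, hz⟩, by simpa using hyz⟩)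
  have hgp : ⇑g = fun y => ∑ i, p i y * g y := by
    ext y
    by_cases hy : y ∈ tsupport g
    · have h1 : ∑ i, p i y = 1 := by simpa using hp1 hy
      rw [← Finset.sum_mul, h1, one_mul]
    · simp [image_eq_zero_of_notMem_tsupport hy]
  have hcont : ∀ i, Continuous fun y => p i y * g y := fun i => (p i).continuous.mul g.continuous
  have hcomp : ∀ i, HasCompactSupport fun y => p i y * g y :=
    fun i => g.hasCompactSupport.mul_left
  rw [hgp, integral_finsetSum _ fun i _ => (hcont i).integrable_of_hasCompactSupport (hcomp i),
    integral_finsetSum _ fun i _ => (hcont i).integrable_of_hasCompactSupport (hcomp i)]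
  refine Finset.sum_congr rfl fun i _ => ?_
  obtain ⟨f, hf, hfc, hfg⟩ := (e (x (t.equivFin.symm i))).exists_finsum_fiber_eq (hcont i)
    (hcomp i) ((tsupport_mul_subset_left (f := p i) (g := g)).trans (hpt i)) (he _)
  simpa only [hfg] using h f hf hfc
end

section
/- Let p : E → X be a covering map, where E is connected and locally compact Hausdorff, X is locally compact, Hausdorff and paracompact, and the group of deck transformations of p acts transitively on each fibre of p. Then E admits a fully supported Radon measure that is invariant under every deck transformation of p if and only if X admits a fully supported Radon measure. -/
open MeasureTheory

open Set Topology in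
/-- In a connected space, a family of sets whose interiors cover and each of whose members meets
only countably many others has a countable subfamily that covers. -/
lemma exists_countable_iUnion_eq_univ {Y ι : Type*} [TopologicalSpace Y] [ConnectedSpace Y]
    (S : ι → Set Y) (hS : ∀ y, ∃ i, y ∈ interior (S i))
    (hcount : ∀ i, {j | (S i ∩ S j).Nonempty}.Countable) :
    ∃ I : Set ι, I.Countable ∧ ⋃ i ∈ I, S i = univ := by
  obtain ⟨y₀⟩ := (inferInstance : Nonempty Y)
  obtain ⟨i₀, hi₀⟩ := hS y₀
  let A : ℕ → Set ι := fun n ↦ Nat.rec {i₀} (fun _ J ↦ ⋃ i ∈ J, {j | (S i ∩ S j).Nonempty}) n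
  have hA : ∀ n, (A n).Countable := by
    intro n
    induction n with
    | zero => exact countable_singleton i₀
    | succ n ih => exact ih.biUnion fun i _ ↦ hcount i
  have hstep : ∀ i ∈ ⋃ n, A n, ∀ j, (S i ∩ S j).Nonempty → j ∈ ⋃ n, A n := by
    intro i hi j hij
    obtain ⟨n, hn⟩ := mem_iUnion.1 hi
    exact mem_iUnion.2 ⟨n + 1, mem_biUnion hn hij⟩
  refine ⟨⋃ n, A n, countable_iUnion hA, ?_⟩
  refine IsClopen.eq_univ ⟨?_, ?_⟩
    ⟨y₀, mem_biUnion (mem_iUnion.2 ⟨0, mem_singleton i₀⟩) (interior_subset hi₀)⟩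
  · refine isClosed_of_closure_subset fun y hy ↦ ?_
    obtain ⟨j, hj⟩ := hS y
    obtain ⟨z, hzj, hz⟩ := mem_closure_iff.1 hy _ isOpen_interior hj
    obtain ⟨i, hi, hzi⟩ := mem_iUnion₂.1 hz
    exact mem_biUnion (hstep i hi j ⟨z, hzi, interior_subset hzj⟩) (interior_subset hj)
  · refine isOpen_iff_mem_nhds.2 fun y hy ↦ ?_
    obtain ⟨i, hi, hyi⟩ := mem_iUnion₂.1 hy
    obtain ⟨j, hj⟩ := hS y
    exact Filter.mem_of_superset (mem_interior_iff_mem_nhds.1 hj)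
      (subset_biUnion_of_mem (u := S) (hstep i hi j ⟨y, hyi, interior_subset hj⟩))

open Set Topology in
lemma sigmaCompactSpace_of_paracompactSpace_of_connectedSpace (X : Type*) [TopologicalSpace X]
    [LocallyCompactSpace X] [ParacompactSpace X] [T2Space X] [ConnectedSpace X] :
    SigmaCompactSpace X := by
  choose K hK hxK using fun x : X ↦ exists_compact_mem_nhds x
  obtain ⟨v, hvo, hvc, hvf, hvK⟩ := precise_refinement (fun x ↦ interior (K x))
    (fun _ ↦ isOpen_interior)
    (iUnion_eq_univ_iff.2 fun x ↦ ⟨x, mem_interior_iff_mem_nhds.2 (hxK x)⟩)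
  obtain ⟨I, hI, hIu⟩ := exists_countable_iUnion_eq_univ v
    (fun y ↦ (iUnion_eq_univ_iff.1 hvc y).imp fun i hi ↦ by rwa [(hvo i).interior_eq])
    (fun i ↦ by
      refine ((hvf.finite_nonempty_inter_compact (hK i)).subset ?_).countable
      rintro j ⟨z, hzi, hzj⟩
      exact ⟨z, hzj, interior_subset (hvK i hzi)⟩)
  refine SigmaCompactSpace.of_countable (K '' I) (hI.image K) ?_ ?_
  · rintro _ ⟨i, -, rfl⟩
    exact hK i
  · rw [sUnion_image, eq_univ_iff_forall]
    intro x
    obtain ⟨i, hi, hxi⟩ := mem_iUnion₂.1 (hIu.symm ▸ mem_univ x)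
    exact mem_biUnion hi (interior_subset (hvK i hxi))

open Set Topology in
/-- A connected covering space of a locally compact, σ-compact space is σ-compact. -/
lemma IsCoveringMap.sigmaCompactSpace {E X : Type*} [TopologicalSpace E] [ConnectedSpace E]
    [TopologicalSpace X] [LocallyCompactSpace X] [T2Space X] [SigmaCompactSpace X] {p : E → X}
    (hp : IsCoveringMap p) (hsurj : Function.Surjective p) : SigmaCompactSpace E := by
  have hne : ∀ x, Nonempty (p ⁻¹' {x}) := fun x ↦ (hsurj x).elim fun e he ↦ ⟨e, he⟩
  have hdisc : ∀ x, DiscreteTopology (p ⁻¹' {x}) := fun x ↦ (hp x).1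
  let T : ∀ x, Bundle.Trivialization (p ⁻¹' {x}) p := fun x ↦ (hp x).toTrivialization
  have hT : ∀ x, x ∈ (T x).baseSet := fun x ↦ (hp x).mem_toTrivialization_baseSet
  choose K hxK hKT hK using fun x ↦
    local_compact_nhds ((T x).open_baseSet.mem_nhds (hT x))
  obtain ⟨Q, hQ, hQu⟩ := countable_cover_nhds_interior hxK
  have : Countable Q := hQ.to_subtype
  let S : (Σ x : Q, p ⁻¹' {(x : X)}) → Set E := fun i ↦ {e | p e ∈ K i.1 ∧ (T i.1 e).2 = i.2}
  have hcompact : ∀ i, IsCompact (S i) := by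
    rintro ⟨x, i⟩
    have hsub : K x ×ˢ {i} ⊆ (T (x : X)).target := fun y hy ↦ (T (x : X)).mem_target.2 (hKT _ hy.1)
    have himage : S ⟨x, i⟩ = (T (x : X)).toOpenPartialHomeomorph.symm '' (K x ×ˢ {i}) := by
      ext e
      constructor
      · rintro ⟨he, hi⟩
        refine ⟨(p e, i), ⟨he, rfl⟩, ?_⟩
        have := (T (x : X)).symm_apply_mk_proj ((T (x : X)).mem_source.2 (hKT _ he))
        rwa [hi] at this
      · rintro ⟨y, hy, rfl⟩
        refine ⟨?_, ?_⟩
        · rw [(T (x : X)).proj_symm_apply (hsub hy)]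
          exact hy.1
        · rw [(T (x : X)).apply_symm_apply (hsub hy)]
          exact hy.2
    rw [himage]
    exact ((hK x).prod isCompact_singleton).image_of_continuousOn
      ((T (x : X)).toOpenPartialHomeomorph.continuousOn_symm.mono hsub)
  have hfinite : ∀ C, IsCompact C → ∀ x : Q, {i | (C ∩ S ⟨x, i⟩).Nonempty}.Finite := by
    intro C hC x
    have hC' : IsCompact (C ∩ p ⁻¹' K x) := hC.inter_right ((hK x).isClosed.preimage hp.continuous)
    have hcont : ContinuousOn (fun e ↦ (T (x : X) e).2) (C ∩ p ⁻¹' K x) :=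
      continuous_snd.comp_continuousOn ((T (x : X)).continuousOn_toFun.mono
        fun e (he : e ∈ C ∩ p ⁻¹' K x) ↦ (T (x : X)).mem_source.2 (hKT _ he.2))
    refine (isCompact_iff_finite.1 (hC'.image_of_continuousOn hcont)).subset ?_
    rintro i ⟨e, heC, heK, hei⟩
    exact ⟨e, ⟨heC, heK⟩, hei⟩
  have hint : ∀ e, ∃ i, e ∈ interior (S i) := by
    intro e
    obtain ⟨x, hx, hex⟩ := mem_iUnion₂.1 (hQu.symm ▸ mem_univ (p e))
    refine ⟨⟨⟨x, hx⟩, (T x e).2⟩, mem_interior_iff_mem_nhds.2 ?_⟩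
    have hsource : e ∈ (T x).source := (T x).mem_source.2 (hKT x (interior_subset hex))
    have hcont : ContinuousAt (fun e ↦ (T x e).2) e :=
      continuousAt_snd.comp ((T x).continuousOn_toFun.continuousAt ((T x).open_source.mem_nhds hsource))
    filter_upwards [hp.continuous.continuousAt (mem_interior_iff_mem_nhds.1 hex),
      hcont (isOpen_discrete {(T x e).2} |>.mem_nhds rfl)] with e' h₁ h₂
    exact ⟨h₁, h₂⟩
  obtain ⟨I, hI, hIu⟩ := exists_countable_iUnion_eq_univ S hint fun i ↦ by
    have : {j | (S i ∩ S j).Nonempty} =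
        ⋃ x, Sigma.mk x '' {k | (S i ∩ S ⟨x, k⟩).Nonempty} := by
      ext ⟨x, k⟩
      refine ⟨fun h ↦ mem_iUnion.2 ⟨x, k, h, rfl⟩, fun h ↦ ?_⟩
      obtain ⟨y, l, hl, heq⟩ := mem_iUnion.1 h
      exact heq ▸ hl
    rw [this]
    exact countable_iUnion fun x ↦ ((hfinite _ (hcompact i) x).image _).countable
  refine SigmaCompactSpace.of_countable (S '' I) (hI.image S) ?_ (by rwa [sUnion_image])
  rintro _ ⟨i, -, rfl⟩
  exact hcompact i

open Set in
/-- The source of a local homeomorphism, if Lindelöf, has a countable cover by open sets on which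
the map is injective. -/
lemma IsLocalHomeomorph.exists_seq_isOpen_injOn {E X : Type*} [TopologicalSpace E]
    [TopologicalSpace X] [LindelofSpace E] [Nonempty E] {p : E → X} (hp : IsLocalHomeomorph p) :
    ∃ W : ℕ → Set E, (∀ n, IsOpen (W n)) ∧ (∀ n, InjOn p (W n)) ∧ ⋃ n, W n = univ := by
  choose W hWo hW hinj using hp.isLocallyInjective
  obtain ⟨Q, hQ, hQu⟩ := countable_cover_nhds fun e ↦ (hWo e).mem_nhds (hW e)
  have hne : Q.Nonempty := by
    rw [nonempty_iff_ne_empty]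
    rintro rfl
    simp [empty_ne_univ] at hQu
  obtain ⟨f, rfl⟩ := hQ.exists_eq_range hne
  exact ⟨fun n ↦ W (f n), fun n ↦ hWo _, fun n ↦ hinj _, by rwa [biUnion_range] at hQu⟩

open Set Topology in
lemma IsLocalHomeomorph.isOpenEmbedding_domRestrict {E X : Type*} [TopologicalSpace E]
    [TopologicalSpace X] {p : E → X} (hp : IsLocalHomeomorph p) {W : Set E}
    (hW : IsOpen W) (hinj : InjOn p W) : IsOpenEmbedding (W.domRestrict p) :=
  .of_continuous_injective_isOpenMap (hp.continuous.comp continuous_subtype_val)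
    (injOn_iff_injective.1 hinj) (hp.isOpenMap.comp hW.isOpenMap_subtype_val)

open Set Measure in
lemma count_inter_fibre {E X : Type*} [MeasurableSpace E] [MeasurableSingletonClass E]
    {p : E → X} {A : Set E} (hA : InjOn p A) (x : X) :
    count (A ∩ p ⁻¹' {x}) = (p '' A).indicator 1 x := by
  by_cases hx : x ∈ p '' A
  · obtain ⟨a, ha, rfl⟩ := hx
    have : A ∩ p ⁻¹' {p a} = {a} := by
      ext b
      exact ⟨fun hb ↦ hA hb.1 ha hb.2, fun (hb : b = a) ↦ hb.symm ▸ ⟨ha, rfl⟩⟩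
    rw [this, count_singleton, indicator_of_mem (mem_image_of_mem p ha), Pi.one_apply]
  · have : A ∩ p ⁻¹' {x} = ∅ := by
      ext b
      exact ⟨fun hb ↦ hx ⟨b, hb.1, hb.2⟩, fun hb ↦ hb.elim⟩
    rw [this, measure_empty, indicator_of_notMem hx]

section FibreMeasure

open Set Topology Measure
open scoped ENNReal

variable {E X : Type*} [TopologicalSpace E] [TopologicalSpace X] [MeasurableSpace E]
  [MeasurableSpace X] {p : E → X}

/-- The lift of a measure along a map, obtained by integrating the counting measures of the
fibres. -/
noncomputable def fibreMeasure (p : E → X) (ν : Measure X) : Measure E :=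
  ν.bind fun x ↦ count.restrict (p ⁻¹' {x})

variable [BorelSpace E] [BorelSpace X]

lemma IsLocalHomeomorph.measurableSet_image (hp : IsLocalHomeomorph p) {W A : Set E}
    (hW : IsOpen W) (hinj : InjOn p W) (hA : MeasurableSet A) (hAW : A ⊆ W) :
    MeasurableSet (p '' A) := by
  have := (hp.isOpenEmbedding_domRestrict hW hinj).measurableEmbedding.measurableSet_image'
    (measurable_subtype_coe hA)
  rwa [show W.domRestrict p '' (Subtype.val ⁻¹' A) = p '' A by
    rw [domRestrict_eq, image_comp, Subtype.image_preimage_coe, inter_eq_right.2 hAW]] at this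

variable [T2Space E] [T2Space X] [LindelofSpace E] [Nonempty E]

lemma measurable_count_restrict_fibre (hp : IsLocalHomeomorph p) :
    Measurable fun x ↦ (count : Measure E).restrict (p ⁻¹' {x}) := by
  obtain ⟨W, hWo, hinj, hWu⟩ := hp.exists_seq_isOpen_injOn
  refine measurable_of_measurable_coe _ fun A hA ↦ ?_
  have hD : ∀ n, MeasurableSet (disjointed W n) := .disjointed fun n ↦ (hWo n).measurableSet
  have hsum : ∀ x, (count : Measure E).restrict (p ⁻¹' {x}) A =
      ∑' n, (p '' (A ∩ disjointed W n)).indicator 1 x := by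
    intro x
    have hfibre : MeasurableSet (p ⁻¹' {x}) :=
      (isClosed_singleton.preimage hp.continuous).measurableSet
    rw [Measure.restrict_apply hA]
    calc count (A ∩ p ⁻¹' {x})
        = count (⋃ n, A ∩ disjointed W n ∩ p ⁻¹' {x}) := by
          rw [← iUnion_inter, ← inter_iUnion, iUnion_disjointed, hWu, inter_univ]
      _ = ∑' n, count (A ∩ disjointed W n ∩ p ⁻¹' {x}) :=
          measure_iUnion (fun i j hij ↦ (disjoint_disjointed W hij).mono
            (inter_subset_left.trans inter_subset_right)
            (inter_subset_left.trans inter_subset_right))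
            fun n ↦ (hA.inter (hD n)).inter hfibre
      _ = _ := tsum_congr fun n ↦ count_inter_fibre
          ((hinj n).mono (inter_subset_right.trans (disjointed_subset W n))) x
  simp_rw [hsum]
  exact Measurable.tsum fun n ↦ measurable_one.indicator (hp.measurableSet_image (hWo n) (hinj n)
    (hA.inter (hD n)) (inter_subset_right.trans (disjointed_subset W n)))

lemma fibreMeasure_apply (hp : IsLocalHomeomorph p) (ν : Measure X) {A : Set E}
    (hA : MeasurableSet A) : fibreMeasure p ν A = ∫⁻ x, count (A ∩ p ⁻¹' {x}) ∂ν := by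
  rw [fibreMeasure, bind_apply hA (measurable_count_restrict_fibre hp).aemeasurable]
  simp_rw [Measure.restrict_apply hA]

lemma fibreMeasure_apply_of_injOn (hp : IsLocalHomeomorph p) (ν : Measure X) {W A : Set E}
    (hW : IsOpen W) (hinj : InjOn p W) (hA : MeasurableSet A) (hAW : A ⊆ W) :
    fibreMeasure p ν A = ν (p '' A) := by
  rw [fibreMeasure_apply hp ν hA]
  simp_rw [count_inter_fibre (hinj.mono hAW)]
  exact lintegral_indicator_one (hp.measurableSet_image hW hinj hA hAW)

lemma map_fibreMeasure (hp : IsLocalHomeomorph p) (ν : Measure X) (φ : E ≃ₜ E)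
    (hφ : p ∘ φ = p) : map φ (fibreMeasure p ν) = fibreMeasure p ν := by
  ext A hA
  rw [map_apply φ.measurable hA, fibreMeasure_apply hp ν (φ.measurable hA),
    fibreMeasure_apply hp ν hA]
  refine lintegral_congr fun x ↦ ?_
  have : φ ⁻¹' A ∩ p ⁻¹' {x} = φ ⁻¹' (A ∩ p ⁻¹' {x}) := by
    rw [preimage_inter, ← preimage_comp, hφ]
  rw [this, ← count_injective_image φ.injective, φ.image_preimage]

lemma isFiniteMeasureOnCompacts_fibreMeasure [WeaklyLocallyCompactSpace X]
    (hp : IsLocalHomeomorph p) (ν : Measure X) [IsFiniteMeasureOnCompacts ν] :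
    IsFiniteMeasureOnCompacts (fibreMeasure p ν) := by
  have : IsLocallyFiniteMeasure (fibreMeasure p ν) := by
    refine ⟨fun e ↦ ?_⟩
    obtain ⟨W, hW, heW, hinj⟩ := hp.isLocallyInjective e
    obtain ⟨K, hK, heK⟩ := exists_compact_mem_nhds (p e)
    have hV : IsOpen (W ∩ p ⁻¹' interior K) := hW.inter (isOpen_interior.preimage hp.continuous)
    refine ⟨_, hV.mem_nhds ⟨heW, mem_interior_iff_mem_nhds.2 heK⟩, ?_⟩
    rw [fibreMeasure_apply_of_injOn hp ν hW hinj hV.measurableSet inter_subset_left]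
    refine (measure_mono ?_).trans_lt hK.measure_lt_top
    rintro _ ⟨a, ha, rfl⟩
    exact interior_subset ha.2
  infer_instance

lemma innerRegular_fibreMeasure (hp : IsLocalHomeomorph p) (ν : Measure X) [ν.InnerRegular] :
    (fibreMeasure p ν).InnerRegular := by
  obtain ⟨W, hWo, hinj, hWu⟩ := hp.exists_seq_isOpen_injOn
  have hD : ∀ n, MeasurableSet (disjointed W n) := .disjointed fun n ↦ (hWo n).measurableSet
  have hreg : ∀ n, ((fibreMeasure p ν).restrict (disjointed W n)).InnerRegular := by
    refine fun n ↦ ⟨fun A hA r hr ↦ ?_⟩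
    have hAW : A ∩ disjointed W n ⊆ W n := inter_subset_right.trans (disjointed_subset W n)
    have hAD := hA.inter (hD n)
    rw [Measure.restrict_apply hA,
      fibreMeasure_apply_of_injOn hp ν (hWo n) (hinj n) hAD hAW] at hr
    obtain ⟨L, hLA, hL, hrL⟩ :=
      (hp.measurableSet_image (hWo n) (hinj n) hAD hAW).exists_lt_isCompact hr
    have hLW : L ⊆ range ((W n).domRestrict p) := by
      rw [range_domRestrict]
      exact hLA.trans (image_mono hAW)
    have hK : IsCompact (Subtype.val '' ((W n).domRestrict p ⁻¹' L)) :=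
      ((hp.isOpenEmbedding_domRestrict (hWo n) (hinj n)).isInducing.isCompact_preimage' hL
        hLW).image continuous_subtype_val
    have hKA : Subtype.val '' ((W n).domRestrict p ⁻¹' L) ⊆ A ∩ disjointed W n := by
      rintro _ ⟨⟨w, hw⟩, hwL, rfl⟩
      obtain ⟨a, ha, hap⟩ := hLA hwL
      exact hinj n (hAW ha) hw hap ▸ ha
    refine ⟨_, hKA.trans inter_subset_left, hK, ?_⟩
    rw [Measure.restrict_apply hK.measurableSet, inter_eq_left.2 (hKA.trans inter_subset_right),
      fibreMeasure_apply_of_injOn hp ν (hWo n) (hinj n) hK.measurableSet (hKA.trans hAW),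
      ← image_comp, ← domRestrict_eq, image_preimage_eq_of_subset hLW]
    exact hrL
  rw [← (fibreMeasure p ν).restrict_univ, ← hWu, ← iUnion_disjointed,
    restrict_iUnion (disjoint_disjointed W) hD]
  infer_instance

lemma fibreMeasure_pos (hp : IsLocalHomeomorph p) (ν : Measure X)
    (hν : ∀ U, IsOpen U → U.Nonempty → 0 < ν U) {U : Set E} (hU : IsOpen U) (hne : U.Nonempty) :
    0 < fibreMeasure p ν U := by
  obtain ⟨e, he⟩ := hne
  obtain ⟨W, hW, heW, hinj⟩ := hp.isLocallyInjective e
  refine lt_of_lt_of_le ?_ (measure_mono (inter_subset_left (s := U) (t := W)))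
  rw [fibreMeasure_apply_of_injOn hp ν hW hinj (hU.inter hW).measurableSet inter_subset_right]
  exact hν _ (hp.isOpenMap _ (hU.inter hW)) ⟨p e, e, ⟨he, heW⟩, rfl⟩

end FibreMeasure

lemma MeasureTheory.Measure.InnerRegular.outerRegular_of_sigmaCompactSpace {α : Type*}
    [TopologicalSpace α] [R1Space α] [SigmaCompactSpace α] [MeasurableSpace α] [BorelSpace α]
    (μ : Measure α) [IsLocallyFiniteMeasure μ] [μ.InnerRegular] : μ.OuterRegular := by
  let s := μ.finiteSpanningSetsInOpen
  refine Measure.OuterRegular.of_restrict (s := s.set) (fun n ↦ ?_) s.set_mem s.spanning.symm.subset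
  have : Fact (μ (s.set n) < ⊤) := ⟨s.finite n⟩
  infer_instance

/-- If a σ-compact space carries a fully supported inner regular measure that is finite on compact
sets, then it carries a finite such measure. -/
lemma exists_isFiniteMeasure_innerRegular_pos {α : Type*} [TopologicalSpace α]
    [R1Space α] [SigmaCompactSpace α] [MeasurableSpace α] [BorelSpace α] (μ : Measure α)
    [IsFiniteMeasureOnCompacts μ] [μ.InnerRegular]
    (hμ : ∀ U : Set α, IsOpen U → U.Nonempty → 0 < μ U) :
    ∃ μ' : Measure α, IsFiniteMeasure μ' ∧ μ'.InnerRegular ∧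
      ∀ U : Set α, IsOpen U → U.Nonempty → 0 < μ' U := by
  have hK : ∀ n, μ (compactCovering α n) < ⊤ := fun n ↦
    (isCompact_compactCovering α n).measure_lt_top
  obtain ⟨δ, hδ, hsum⟩ := ENNReal.exists_pos_tsum_mul_lt_of_countable one_ne_zero
    (fun n ↦ μ (compactCovering α n)) fun n ↦ (hK n).ne
  have : ∀ n, Fact (μ (compactCovering α n) < ⊤) := fun n ↦ ⟨hK n⟩
  refine ⟨.sum fun n ↦ δ n • μ.restrict (compactCovering α n), ⟨?_⟩, inferInstance,
    fun U hU hne ↦ ?_⟩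
  · rw [Measure.sum_apply _ .univ]
    simp only [Measure.smul_apply, Measure.restrict_apply_univ, ENNReal.smul_def, smul_eq_mul]
    simp_rw [mul_comm (μ _)] at hsum
    exact hsum.trans ENNReal.one_lt_top
  · refine pos_iff_ne_zero.2 fun h ↦ (hμ U hU hne).ne' ?_
    rw [Measure.sum_apply _ hU.measurableSet, ENNReal.tsum_eq_zero] at h
    rw [← Set.inter_univ U, ← iUnion_compactCovering α, Set.inter_iUnion]
    refine measure_iUnion_null fun n ↦ ?_
    have := h n
    rw [Measure.smul_apply, Measure.restrict_apply hU.measurableSet, ENNReal.smul_def, smul_eq_mul,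
      mul_eq_zero] at this
    exact this.resolve_left (by simpa using (hδ n).ne')

/-- Let `p : E → X` be a covering map with `E` connected, locally compact and
Hausdorff, `X` locally compact Hausdorff paracompact, whose deck transformation group acts
transitively on fibres. Then `E` admits a fully supported Radon measure invariant under all
deck transformations iff `X` admits a fully supported Radon measure. -/
theorem exists_deck_invariant_measure_iff
    {E X : Type*} [TopologicalSpace E] [LocallyCompactSpace E] [T2Space E]
    [ConnectedSpace E]
    [TopologicalSpace X] [LocallyCompactSpace X] [T2Space X] [ParacompactSpace X]
    [MeasurableSpace E] [BorelSpace E] [MeasurableSpace X] [BorelSpace X]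
    {p : E → X} (hp : IsCoveringMap p) (hpsurj : Function.Surjective p)
    (hdeck : ∀ e e' : E, p e = p e' → ∃ φ : E ≃ₜ E, p ∘ φ = p ∧ φ e = e') :
    (∃ lam : Measure E, IsRadonMeasure lam ∧
        (∀ U : Set E, IsOpen U → U.Nonempty → 0 < lam U) ∧
        (∀ φ : E ≃ₜ E, p ∘ φ = p → Measure.map φ lam = lam)) ↔
      (∃ ν : Measure X, IsRadonMeasure ν ∧
        (∀ U : Set X, IsOpen U → U.Nonempty → 0 < ν U)) := by
  have hX : ConnectedSpace X := hpsurj.connectedSpace hp.continuous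
  have := sigmaCompactSpace_of_paracompactSpace_of_connectedSpace X
  have := hp.sigmaCompactSpace hpsurj
  have hloc := hp.isLocalHomeomorph
  constructor
  · rintro ⟨lam, ⟨_, _, _⟩, hpos, -⟩
    obtain ⟨μ, _, _, hμ⟩ := exists_isFiniteMeasure_innerRegular_pos lam hpos
    have : (Measure.map p μ).InnerRegular := .map_of_continuous hp.continuous
    refine ⟨Measure.map p μ, ⟨inferInstance, inferInstance, this⟩, fun U hU hne ↦ ?_⟩
    rw [Measure.map_apply hp.continuous.measurable hU.measurableSet]
    exact hμ _ (hU.preimage hp.continuous) (hne.preimage hpsurj)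
  · rintro ⟨ν, ⟨_, _, _⟩, hpos⟩
    have := isFiniteMeasureOnCompacts_fibreMeasure hloc ν
    have := innerRegular_fibreMeasure hloc ν
    exact ⟨fibreMeasure p ν,
      ⟨inferInstance, Measure.InnerRegular.outerRegular_of_sigmaCompactSpace _, inferInstance⟩,
      fun U hU hne ↦ fibreMeasure_pos hloc ν hpos hU hne, fun φ hφ ↦ map_fibreMeasure hloc ν φ hφ⟩
end

section
/- Let X be a nonempty compact Hausdorff space and let σ : X → X be a homeomorphism such that the induced ℤ-action is transitive, i.e. for all x, y ∈ X there exists n ∈ ℤ with σⁿ(x) = y. Then there exists a σ-invariant Radon probability measure on X with full support. -/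
open MeasureTheory

/-- A Baire T1 space on which a homeomorphism acts with a single orbit is discrete. -/
theorem discreteTopology_of_transitive_zpow {X : Type*} [TopologicalSpace X] [BaireSpace X]
    [T1Space X] (σ : X ≃ₜ X)
    (htrans : ∀ x y : X, ∃ n : ℤ, (σ.toEquiv ^ n) x = y) : DiscreteTopology X := by
  rcases isEmpty_or_nonempty X with _ | _
  · infer_instance
  let x : X := Classical.arbitrary X
  obtain ⟨m, z, hz⟩ := nonempty_interior_of_iUnion_of_closed
    (f := fun n : ℤ => {(σ.toEquiv ^ n) x}) (fun _ => isClosed_singleton)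
    (Set.eq_univ_of_forall fun y => by
      obtain ⟨n, hn⟩ := htrans x y
      exact Set.mem_iUnion.2 ⟨n, hn.symm⟩)
  have hzm : z = (σ.toEquiv ^ m) x := Set.mem_singleton_iff.1 (interior_subset hz)
  have hopen : IsOpen {z} := by
    have h : interior {(σ.toEquiv ^ m) x} = {z} := by
      rw [← hzm] at hz ⊢
      exact interior_subset.antisymm (Set.singleton_subset_iff.2 hz)
    exact h ▸ isOpen_interior
  have hstep (w : X) : IsOpen {σ w} ↔ IsOpen {w} := by
    rw [← Set.image_singleton, σ.isOpen_image]
  have hsucc (n : ℤ) : IsOpen {(σ.toEquiv ^ (n + 1)) z} ↔ IsOpen {(σ.toEquiv ^ n) z} := by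
    rw [add_comm, zpow_add, zpow_one]
    exact hstep _
  have horbit (n : ℤ) : IsOpen {(σ.toEquiv ^ n) z} := by
    induction n with
    | zero => simpa using hopen
    | succ n ih => exact (hsucc _).2 ih
    | pred n ih => exact (hsucc _).1 (by simpa using ih)
  refine discreteTopology_iff_isOpen_singleton.2 fun y => ?_
  obtain ⟨n, rfl⟩ := htrans z y
  exact horbit n

/-- Every finite measure on a finite discrete space is a Radon measure. -/
theorem isRadonMeasure_of_finite {X : Type*} [TopologicalSpace X] [DiscreteTopology X] [Finite X]
    [MeasurableSpace X] (μ : Measure X) [IsFiniteMeasure μ] : IsRadonMeasure μ :=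
  ⟨inferInstance,
    ⟨fun A _ _ hr => ⟨A, subset_rfl, isOpen_discrete A, hr⟩⟩,
    ⟨fun A _ _ hr => ⟨A, subset_rfl, A.toFinite.isCompact, hr⟩⟩⟩

/-- Let `X` be a nonempty compact Hausdorff space and `σ : X → X` a
homeomorphism whose induced `ℤ`-action is transitive. Then there is a `σ`-invariant Radon
probability measure on `X` with full support. -/
theorem exists_invariant_fully_supported_prob_measure
    {X : Type*} [TopologicalSpace X] [CompactSpace X] [T2Space X] [Nonempty X]
    [MeasurableSpace X] [BorelSpace X]
    (σ : X ≃ₜ X)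
    (htrans : ∀ x y : X, ∃ n : ℤ, (σ.toEquiv ^ n) x = y) :
    ∃ μ : Measure X, IsProbabilityMeasure μ ∧ IsRadonMeasure μ ∧
      Measure.map σ μ = μ ∧
      (∀ U : Set X, IsOpen U → U.Nonempty → 0 < μ U) := by
  have := discreteTopology_of_transitive_zpow σ htrans
  have : Finite X := finite_of_compact_of_discrete
  have hfin : (Measure.count (Set.univ : Set X)) ≠ ⊤ :=
    (Measure.count_apply_lt_top.2 Set.finite_univ).ne
  have hpos : (Measure.count (Set.univ : Set X)) ≠ 0 :=
    Measure.count_ne_zero Set.univ_nonempty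
  have hprob : IsProbabilityMeasure ((Measure.count (Set.univ : Set X))⁻¹ • Measure.count) :=
    ⟨by rw [Measure.smul_apply, smul_eq_mul, ENNReal.inv_mul_cancel hpos hfin]⟩
  refine ⟨_, hprob, isRadonMeasure_of_finite _, ?_, fun U _ hne => ?_⟩
  · rw [Measure.map_smul]
    congr 1
    ext s hs
    rw [Measure.map_apply σ.measurable hs, Measure.count_apply (σ.measurable hs),
      Measure.count_apply hs, ← σ.image_symm, σ.symm.injective.encard_image]
  · rw [Measure.smul_apply, smul_eq_mul]
    exact ENNReal.mul_pos (ENNReal.inv_ne_zero.2 hfin) (Measure.count_ne_zero hne)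
end
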